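/- Let T = X + iY satisfy assumption (A). Then for all ψ, φ each of which is either a function in C¹₁([a,b]) or a polynomial with complex coefficients, the commutator [ψ(Y), φ(X)] is a trace-class operator. -/

import Mathlib

open scoped InnerProductSpace
open MeasureTheory Polynomial

namespace HHCP

variable {H : Type*} [NormedAddCommGroup H] [InnerProductSpace ℂ H] [CompleteSpace H]
  [TopologicalSpace.SeparableSpace H]

/-- `f(A)` for a function `f` of a real variable, applied to the (selfadjoint, hence
star-normal) bounded operator `A` via the continuous functional calculus. -/
noncomputable def fc (f : ℝ → ℂ) (A : H →L[ℂ] H) : H →L[ℂ] H :=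
  cfc (fun z : ℂ => f z.re) A

/-- `|A| = √(A⋆A)`. -/
noncomputable def absOp (A : H →L[ℂ] H) : H →L[ℂ] H :=
  cfc Real.sqrt (ContinuousLinearMap.adjoint A * A)

/-- `A` is of trace class, i.e. `∑ ⟪eᵢ, |A| eᵢ⟫ < ∞` (this is independent of the
choice of the Hilbert basis `e`). -/
def IsTraceClass {ι : Type*} (e : HilbertBasis ι ℂ H) (A : H →L[ℂ] H) : Prop :=
  Summable fun i => (⟪e i, absOp A (e i)⟫_ℂ).re

/-- The trace norm `‖A‖₁ = Tr |A|`. -/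
noncomputable def traceNorm {ι : Type*} (e : HilbertBasis ι ℂ H) (A : H →L[ℂ] H) : ℝ :=
  ∑' i, (⟪e i, absOp A (e i)⟫_ℂ).re

/-- The trace `Tr A = ∑ᵢ ⟪eᵢ, A eᵢ⟫`. -/
noncomputable def trace {ι : Type*} (e : HilbertBasis ι ℂ H) (A : H →L[ℂ] H) : ℂ :=
  ∑' i, ⟪e i, A (e i)⟫_ℂ

/-- `T` is hyponormal (`‖T⋆x‖ ≤ ‖Tx‖`, i.e. `[T⋆,T] ≥ 0`) and *purely* so: there is no
nonzero closed subspace, invariant under `T` and `T⋆`, on which `T` is normal. -/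
def PurelyHyponormal (T : H →L[ℂ] H) : Prop :=
  (∀ x : H, ‖ContinuousLinearMap.adjoint T x‖ ≤ ‖T x‖) ∧
  ∀ S : Submodule ℂ H, IsClosed (S : Set H) →
    (∀ x ∈ S, T x ∈ S) → (∀ x ∈ S, ContinuousLinearMap.adjoint T x ∈ S) →
    (∀ x ∈ S, ‖T x‖ = ‖ContinuousLinearMap.adjoint T x‖) → S = ⊥

/-- Assumption (A): `T = X + iY` is purely hyponormal with `X, Y` selfadjoint,
`[T⋆,T] = −2i[Y,X] = 2D²` is a positive trace-class operator, and
`σ(X) ∪ σ(Y) ⊆ [a,b]`. -/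
structure AssumptionA {ι : Type*} (e : HilbertBasis ι ℂ H)
    (X Y D2 : H →L[ℂ] H) (a b : ℝ) : Prop where
  hab : a ≤ b
  hX : IsSelfAdjoint X
  hY : IsSelfAdjoint Y
  hpure : PurelyHyponormal (X + Complex.I • Y)
  hD2 : (2 : ℂ) • D2 = (-(2 : ℂ) * Complex.I) • (Y * X - X * Y)
  hpos : D2.IsPositive
  htc : IsTraceClass e D2
  hspecX : spectrum ℝ X ⊆ Set.Icc a b
  hspecY : spectrum ℝ Y ⊆ Set.Icc a b

/-- `ψ ∈ C¹₁`: `ψ(β) = (2π)^{-1/2} ∫ ψ̂(α) e^{iαβ} dα` for some `ψ̂` with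
`∫ |ψ̂(α)|(1+|α|) dα < ∞`. -/
def MemC11 (ψ : ℝ → ℂ) : Prop :=
  ∃ g : ℝ → ℂ, Integrable g ∧ Integrable (fun α : ℝ => α • g α) ∧
    ∀ β : ℝ, ψ β = (Real.sqrt (2 * Real.pi))⁻¹ •
      ∫ α : ℝ, Complex.exp (Complex.I * (α : ℂ) * (β : ℂ)) • g α

/-- `ψ` is (the function given by) a polynomial with complex coefficients. -/
def IsPolyFun (ψ : ℝ → ℂ) : Prop :=
  ∃ p : Polynomial ℂ, ∀ t : ℝ, ψ t = Polynomial.eval (t : ℂ) p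

/-- `ψ` is either in `C¹₁([a,b])` or a polynomial. -/
def GoodFun (ψ : ℝ → ℂ) : Prop := MemC11 ψ ∨ IsPolyFun ψ

/-- `E` is the spectral measure of the selfadjoint operator `A`: a projection-valued,
countably additive measure on `ℝ` such that `⟪x, f(A) x⟫ = ∫ f dμ_x`, where `μ_x` is the
finite positive measure `μ_x(Δ) = ⟪x, E(Δ) x⟫`. -/
def IsSpectralMeasureOf (A : H →L[ℂ] H) (E : Set ℝ → H →L[ℂ] H) : Prop :=
  (∀ Δ : Set ℝ, IsSelfAdjoint (E Δ)) ∧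
  (∀ Δ Ω : Set ℝ, E (Δ ∩ Ω) = E Δ * E Ω) ∧
  E Set.univ = 1 ∧
  (∀ Δ : ℕ → Set ℝ, (∀ n, MeasurableSet (Δ n)) → Pairwise (Function.onFun Disjoint Δ) →
    ∀ x : H, HasSum (fun n => E (Δ n) x) (E (⋃ n, Δ n) x)) ∧
  ∀ x : H, ∃ μ : Measure ℝ, IsFiniteMeasure μ ∧
    (∀ Δ : Set ℝ, MeasurableSet Δ → (μ Δ).toReal = (⟪x, E Δ x⟫_ℂ).re) ∧
    ∀ f : ℝ → ℝ, Continuous f → (⟪x, cfc f A x⟫_ℂ).re = ∫ t, f t ∂μ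

/-- An indefinite integral `𝒥(χ_Δ)` of the characteristic function of `Δ`. -/
noncomputable def Jind (a : ℝ) (Δ : Set ℝ) (t : ℝ) : ℝ :=
  ∫ s in a..t, Set.indicator Δ (fun _ => (1 : ℝ)) s

/-- `𝒥(χ_Δ)(A)`. -/
noncomputable def JindOp (a : ℝ) (Δ : Set ℝ) (A : H →L[ℂ] H) : H →L[ℂ] H :=
  fc (fun t => (Jind a Δ t : ℂ)) A

/-- `ψ ∈ C¹([a,b])` with derivative `ψd` on `[a,b]`. -/
def HasDerivOnIcc (ψ ψd : ℝ → ℂ) (a b : ℝ) : Prop :=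
  (∀ t ∈ Set.Icc a b, HasDerivWithinAt ψ (ψd t) (Set.Icc a b) t) ∧
  ContinuousOn ψd (Set.Icc a b)

/-- `r` is a Carey–Pincus principal function for the pair `X, Y`: a nonnegative
`L¹([a,b]²)` function with `Tr(−i[ψ(Y), φ(X)]) = ∫∫ φ′(t) ψ′(λ) r(t,λ) dt dλ`
for all `ψ, φ ∈ C¹([a,b])`. -/
def IsPrincipalFunction {ι : Type*} (e : HilbertBasis ι ℂ H) (X Y : H →L[ℂ] H)
    (a b : ℝ) (r : ℝ → ℝ → ℝ) : Prop :=
  IntegrableOn (fun q : ℝ × ℝ => r q.1 q.2) (Set.Icc a b ×ˢ Set.Icc a b) ∧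
  (∀ᵐ q : ℝ × ℝ ∂(volume : Measure (ℝ × ℝ)),
    q ∈ Set.Icc a b ×ˢ Set.Icc a b → 0 ≤ r q.1 q.2) ∧
  ∀ ψ ψd φ φd : ℝ → ℂ, HasDerivOnIcc ψ ψd a b → HasDerivOnIcc φ φd a b →
    trace e ((-Complex.I) • (fc ψ Y * fc φ X - fc φ X * fc ψ Y)) =
      ∫ t in Set.Icc a b, ∫ l in Set.Icc a b, φd t * ψd l * (r t l : ℂ)

/-- The Jacobian `J(F,G)(t,λ) = ∂F/∂t ∂G/∂λ − ∂F/∂λ ∂G/∂t`. -/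
noncomputable def Jac (F G : ℝ → ℝ → ℂ) (t l : ℝ) : ℂ :=
  deriv (fun s => F s l) t * deriv (fun s => G t s) l -
    deriv (fun s => F t s) l * deriv (fun s => G s l) t

set_option linter.unusedSectionVars false

/-- Uniform trace-norm bound, tested against contractions. -/
def TCB {ι : Type*} (e : HilbertBasis ι ℂ H) (A : H →L[ℂ] H) (C : ℝ) : Prop :=
  ∀ U V : H →L[ℂ] H, ‖U‖ ≤ 1 → ‖V‖ ≤ 1 → ∀ s : Finset ι,
    ∑ i ∈ s, ‖⟪U (e i), A (V (e i))⟫_ℂ‖ ≤ C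

theorem TCB.add {ι : Type*} {e : HilbertBasis ι ℂ H} {A B : H →L[ℂ] H} {C D : ℝ}
    (hA : TCB e A C) (hB : TCB e B D) : TCB e (A + B) (C + D) := by
  intro U V hU hV s
  refine le_trans ?_ (add_le_add (hA U V hU hV s) (hB U V hU hV s))
  rw [← Finset.sum_add_distrib]
  refine Finset.sum_le_sum fun i _ => ?_
  rw [add_apply, inner_add_right]
  exact norm_add_le _ _

theorem TCB.smul {ι : Type*} {e : HilbertBasis ι ℂ H} {A : H →L[ℂ] H} {C : ℝ}
    (hA : TCB e A C) (c : ℂ) : TCB e (c • A) (‖c‖ * C) := by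
  intro U V hU hV s
  refine le_trans (le_of_eq ?_) (mul_le_mul_of_nonneg_left (hA U V hU hV s) (norm_nonneg c))
  rw [Finset.mul_sum]
  refine Finset.sum_congr rfl fun i _ => ?_
  rw [smul_apply, inner_smul_right, norm_mul]

theorem TCB.conj {ι : Type*} {e : HilbertBasis ι ℂ H} {A : H →L[ℂ] H} {C : ℝ}
    (hA : TCB e A C) {B B' : H →L[ℂ] H} (hB : ‖B‖ ≤ 1) (hB' : ‖B'‖ ≤ 1) :
    TCB e (B * A * B') C := by
  intro U V hU hV s
  have h1 : ‖ContinuousLinearMap.adjoint B * U‖ ≤ 1 := by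
    refine (norm_mul_le _ _).trans ?_
    rw [LinearIsometryEquiv.norm_map]
    exact mul_le_one₀ hB (norm_nonneg _) hU
  have h2 : ‖B' * V‖ ≤ 1 := (norm_mul_le _ _).trans (mul_le_one₀ hB' (norm_nonneg _) hV)
  refine le_trans (le_of_eq ?_) (hA _ _ h1 h2 s)
  refine Finset.sum_congr rfl fun i _ => ?_
  simp [ContinuousLinearMap.adjoint_inner_left]

theorem TCB.exists_mul {ι : Type*} {e : HilbertBasis ι ℂ H} {A : H →L[ℂ] H} {C : ℝ}
    (hA : TCB e A C) (B B' : H →L[ℂ] H) : ∃ C', TCB e (B * A * B') C' := by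
  have key : ∀ B : H →L[ℂ] H, ∃ (c : ℂ) (B0 : H →L[ℂ] H), ‖B0‖ ≤ 1 ∧ B = c • B0 := by
    intro B
    have hp : (0 : ℝ) < ‖B‖ + 1 := by positivity
    have hne : ((‖B‖ + 1 : ℝ) : ℂ) ≠ 0 := by exact_mod_cast hp.ne'
    refine ⟨((‖B‖ + 1 : ℝ) : ℂ), (((‖B‖ + 1 : ℝ) : ℂ))⁻¹ • B, ?_, ?_⟩
    · rw [norm_smul, norm_inv, Complex.norm_real, Real.norm_of_nonneg hp.le,
        inv_mul_le_iff₀ hp]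
      linarith
    · rw [smul_smul, mul_inv_cancel₀ hne, one_smul]
  obtain ⟨c, B0, h0, rfl⟩ := key B
  obtain ⟨d, B1, h1, rfl⟩ := key B'
  refine ⟨‖d * c‖ * C, ?_⟩
  have := (hA.conj h0 h1).smul (d * c)
  convert this using 1
  simp only [smul_mul_assoc, mul_smul_comm, smul_smul]

theorem TCB.integral {ι : Type*} {e : HilbertBasis ι ℂ H} {μ : Measure ℝ}
    {F : ℝ → H →L[ℂ] H} {c : ℝ → ℝ} (hF : Integrable F μ) (hc : Integrable c μ)
    (h : ∀ t, TCB e (F t) (c t)) : TCB e (∫ t, F t ∂μ) (∫ t, c t ∂μ) := by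
  intro U V hU hV s
  have hint : ∀ i, Integrable (fun t => ⟪U (e i), F t (V (e i))⟫_ℂ) μ := by
    intro i
    exact (hF.apply_continuousLinearMap (V (e i))).const_inner (U (e i))
  have heq : ∀ i, ⟪U (e i), (∫ t, F t ∂μ) (V (e i))⟫_ℂ = ∫ t, ⟪U (e i), F t (V (e i))⟫_ℂ ∂μ := by
    intro i
    rw [ContinuousLinearMap.integral_apply hF, integral_inner]
    exact hF.apply_continuousLinearMap _
  calc ∑ i ∈ s, ‖⟪U (e i), (∫ t, F t ∂μ) (V (e i))⟫_ℂ‖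
      ≤ ∑ i ∈ s, ∫ t, ‖⟪U (e i), F t (V (e i))⟫_ℂ‖ ∂μ := by
        refine Finset.sum_le_sum fun i _ => ?_
        rw [heq]
        exact norm_integral_le_integral_norm _
    _ = ∫ t, ∑ i ∈ s, ‖⟪U (e i), F t (V (e i))⟫_ℂ‖ ∂μ :=
        (integral_finsetSum s fun i _ => (hint i).norm).symm
    _ ≤ ∫ t, c t ∂μ :=
        integral_mono (integrable_finsetSum s fun i _ => (hint i).norm) hc
          fun t => h t U V hU hV s

theorem TCB.isTraceClass {ι : Type*} {e : HilbertBasis ι ℂ H} {A : H →L[ℂ] H} {C : ℝ}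
    (hA : TCB e A C) : IsTraceClass e A := by
  unfold IsTraceClass absOp
  set P : H →L[ℂ] H := ContinuousLinearMap.adjoint A * A with hP
  have hPn : 0 ≤ P := star_mul_self_nonneg A
  have hPs : IsSelfAdjoint P := .of_nonneg hPn
  have hsp : ∀ t ∈ spectrum ℝ P, 0 ≤ t := fun t ht => spectrum_nonneg_of_nonneg hPn ht
  have hmono : ∀ S T : H →L[ℂ] H, S ≤ T → ∀ x : H, (⟪x, S x⟫_ℂ).re ≤ (⟪x, T x⟫_ℂ).re := by
    intro S T h x
    have h' := ((ContinuousLinearMap.le_def S T).1 h).re_inner_nonneg_right x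
    simp only [sub_apply, inner_sub_right] at h'
    simpa using h'
  refine summable_of_sum_le (c := C) (fun i => ?_) fun s => ?_
  · have := hmono 0 _ (cfc_nonneg (a := P) (f := Real.sqrt) fun t _ => Real.sqrt_nonneg t) (e i)
    simpa using this
  refine le_of_forall_pos_le_add fun δ hδ => ?_
  obtain ⟨ε, hε, hεs⟩ : ∃ ε : ℝ, 0 < ε ∧ s.card * ε ≤ δ := by
    refine ⟨δ / (s.card + 1), by positivity, ?_⟩
    rw [mul_div_assoc', div_le_iff₀ (by positivity)]
    nlinarith
  have hpos : ∀ t : ℝ, 0 < Real.sqrt t + ε := fun t => by positivity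
  have hcont : Continuous fun t : ℝ => (Real.sqrt t + ε)⁻¹ :=
    (Real.continuous_sqrt.add continuous_const).inv₀ fun t => (hpos t).ne'
  set R : H →L[ℂ] H := cfc (fun t : ℝ => (Real.sqrt t + ε)⁻¹) P with hR
  have hRs : IsSelfAdjoint R := cfc_predicate _ _
  have hRP : R * P = cfc (fun t : ℝ => (Real.sqrt t + ε)⁻¹ * t) P := by
    rw [cfc_mul (fun t : ℝ => (Real.sqrt t + ε)⁻¹) (fun t : ℝ => t) P hcont.continuousOn
      continuousOn_id, cfc_id' ℝ P]
  have hcont2 : Continuous fun t : ℝ => (Real.sqrt t + ε)⁻¹ * t := hcont.mul continuous_id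
  have hRPR : R * P * R = cfc (fun t : ℝ => (Real.sqrt t + ε)⁻¹ * t * (Real.sqrt t + ε)⁻¹) P := by
    rw [hRP, hR, cfc_mul _ _ P hcont2.continuousOn hcont.continuousOn]
  have hW : ‖A * R‖ ≤ 1 := by
    have h1 : ‖A * R‖ * ‖A * R‖ = ‖R * P * R‖ := by
      rw [← CStarRing.norm_star_mul_self, star_mul, hRs.star_eq, hP]
      simp only [mul_assoc, ContinuousLinearMap.star_eq_adjoint]
    have h2 : ‖R * P * R‖ ≤ 1 := by
      rw [hRPR]
      refine norm_cfc_le zero_le_one fun t ht => ?_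
      have ht := hsp t ht
      have := hpos t
      rw [Real.norm_of_nonneg (by positivity), mul_comm, ← mul_assoc, ← mul_inv,
        inv_mul_le_iff₀ (by positivity)]
      nlinarith [Real.sq_sqrt ht, Real.sqrt_nonneg t]
    nlinarith [norm_nonneg (A * R)]
  have hle : cfc Real.sqrt P ≤ R * P + algebraMap ℝ (H →L[ℂ] H) ε := by
    rw [hRP, ← cfc_const ε P, ← cfc_add (a := P) _ _ hcont2.continuousOn continuousOn_const]
    refine cfc_mono (fun t ht => ?_) (by fun_prop)
      (hcont2.add continuous_const).continuousOn
    have ht := hsp t ht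
    have := hpos t
    rw [← sub_nonneg]
    have : (Real.sqrt t + ε)⁻¹ * t + ε - Real.sqrt t = (Real.sqrt t + ε)⁻¹ * ε ^ 2 := by
      field_simp
      nlinarith [Real.sq_sqrt ht]
    rw [this]; positivity
  have hb := hA (A * R) 1 hW ContinuousLinearMap.norm_id_le s
  calc ∑ i ∈ s, (⟪e i, cfc Real.sqrt P (e i)⟫_ℂ).re
      ≤ ∑ i ∈ s, (‖⟪(A * R) (e i), A ((1 : H →L[ℂ] H) (e i))⟫_ℂ‖ + ε) := by
        refine Finset.sum_le_sum fun i _ => (hmono _ _ hle (e i)).trans ?_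
        have h3 : ⟪(A * R) (e i), A ((1 : H →L[ℂ] H) (e i))⟫_ℂ = ⟪e i, (R * P) (e i)⟫_ℂ := by
          have hRa : ContinuousLinearMap.adjoint R = R := hRs
          simp only [mul_apply_eq_comp, one_apply_eq_self, hP]
          rw [← ContinuousLinearMap.adjoint_inner_right A, ← ContinuousLinearMap.adjoint_inner_right R,
            hRa]
        rw [h3, add_apply, inner_add_right, Complex.add_re]
        refine add_le_add (Complex.re_le_norm _) (le_of_eq ?_)
        have hn : ‖e i‖ = 1 := e.orthonormal.1 i
        rw [Algebra.algebraMap_eq_smul_one, smul_apply,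
          one_apply_eq_self, ← Complex.coe_smul, inner_smul_right,
          inner_self_eq_norm_sq_to_K, hn]
        simp
    _ ≤ C + δ := by
        rw [Finset.sum_add_distrib, Finset.sum_const, nsmul_eq_mul]
        exact add_le_add hb hεs

theorem TCB.of_positive {ι : Type*} {e : HilbertBasis ι ℂ H} {A : H →L[ℂ] H}
    (hpos : A.IsPositive) (htc : IsTraceClass e A) : ∃ C, TCB e A C := by
  have hAn : 0 ≤ A := (ContinuousLinearMap.nonneg_iff_isPositive A).2 hpos
  have hAs : IsSelfAdjoint A := .of_nonneg hAn
  have hsp : ∀ t ∈ spectrum ℝ A, 0 ≤ t := fun t ht => spectrum_nonneg_of_nonneg hAn ht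
  have habs : absOp A = A := by
    have h1 : ContinuousLinearMap.adjoint A = A := hAs
    unfold absOp
    rw [h1]
    have h2 : A * A = cfc (fun t : ℝ => t * t) A := by
      rw [cfc_mul _ _ A, cfc_id' ℝ A]
    rw [h2, ← cfc_comp' Real.sqrt (fun t : ℝ => t * t) A]
    conv_rhs => rw [← cfc_id' ℝ A]
    exact cfc_congr fun t ht => Real.sqrt_mul_self (hsp t ht)
  obtain ⟨D, hDs, hD⟩ : ∃ D : H →L[ℂ] H, ContinuousLinearMap.adjoint D = D ∧ D * D = A := by
    refine ⟨cfc Real.sqrt A, (cfc_predicate Real.sqrt A : IsSelfAdjoint _), ?_⟩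
    rw [← cfc_mul _ _ A]
    conv_rhs => rw [← cfc_id' ℝ A]
    exact cfc_congr fun t ht => Real.mul_self_sqrt (hsp t ht)
  have hsum : Summable fun i => ‖D (e i)‖ ^ 2 := by
    unfold IsTraceClass at htc
    rw [habs] at htc
    convert htc using 2 with i
    rw [← hD, mul_apply_eq_comp, ← ContinuousLinearMap.adjoint_inner_left, hDs,
      inner_self_eq_norm_sq_to_K]
    norm_cast
  have key : ∀ U : H →L[ℂ] H, ‖U‖ ≤ 1 → ∀ s : Finset ι,
      ∑ i ∈ s, ‖D (U (e i))‖ ^ 2 ≤ ∑' j, ‖D (e j)‖ ^ 2 := by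
    intro U hU s
    have hpars : ∀ x : H, HasSum (fun j => ‖⟪e j, x⟫_ℂ‖ ^ 2) (‖x‖ ^ 2) := by
      intro x
      have := (e.hasSum_inner_mul_inner x x).mapL Complex.reCLM
      convert this using 1
      · ext j
        simp only [Complex.reCLM_apply]
        rw [← inner_conj_symm x (e j), Complex.conj_mul']
        norm_cast
      · rw [Complex.reCLM_apply, inner_self_eq_norm_sq_to_K]
        norm_cast
    have h1 : HasSum (fun j => ∑ i ∈ s, ‖⟪e j, D (U (e i))⟫_ℂ‖ ^ 2)
        (∑ i ∈ s, ‖D (U (e i))‖ ^ 2) := hasSum_sum fun i _ => hpars _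
    refine hasSum_le (fun j => ?_) h1 hsum.hasSum
    have h2 : ∀ i, ‖⟪e j, D (U (e i))⟫_ℂ‖ =
        ‖⟪e i, ContinuousLinearMap.adjoint U (D (e j))⟫_ℂ‖ := by
      intro i
      rw [ContinuousLinearMap.adjoint_inner_right, ← ContinuousLinearMap.adjoint_inner_left, hDs,
        norm_inner_symm]
    simp only [h2]
    refine (e.orthonormal.sum_inner_products_le _).trans ?_
    have h3 : ‖ContinuousLinearMap.adjoint U (D (e j))‖ ≤ ‖D (e j)‖ := by
      refine (ContinuousLinearMap.le_opNorm _ _).trans ?_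
      rw [LinearIsometryEquiv.norm_map]
      exact mul_le_of_le_one_left (norm_nonneg _) hU
    gcongr
  refine ⟨∑' j, ‖D (e j)‖ ^ 2, fun U V hU hV s => ?_⟩
  have hU' := key U hU s
  have hV' := key V hV s
  have : ∑ i ∈ s, ‖⟪U (e i), A (V (e i))⟫_ℂ‖ ≤
      ∑ i ∈ s, (‖D (U (e i))‖ ^ 2 + ‖D (V (e i))‖ ^ 2) / 2 := by
    refine Finset.sum_le_sum fun i _ => ?_
    rw [← hD, mul_apply_eq_comp, ← ContinuousLinearMap.adjoint_inner_left, hDs]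
    refine (norm_inner_le_norm _ _).trans ?_
    nlinarith [sq_nonneg (‖D (U (e i))‖ - ‖D (V (e i))‖)]
  rw [← Finset.sum_div, Finset.sum_add_distrib] at this
  linarith

theorem re_eq_of_mem {X : H →L[ℂ] H} (hX : IsSelfAdjoint X) {z : ℂ} (hz : z ∈ spectrum ℂ X) :
    ((z.re : ℝ) : ℂ) = z := (hX.mem_spectrum_eq_re hz).symm

/-- The unitary group generated by `X`. -/
noncomputable def ug (X : H →L[ℂ] H) (t : ℝ) : H →L[ℂ] H :=
  NormedSpace.exp (t • (Complex.I • X))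

theorem fc_exp {X : H →L[ℂ] H} (hX : IsSelfAdjoint X) (t : ℝ) :
    cfc (fun z : ℂ => Complex.exp (Complex.I * (t : ℂ) * (z.re : ℂ))) X = ug X t := by
  have hn : IsStarNormal X := hX.isStarNormal
  have h1 : cfc (fun z : ℂ => Complex.exp (Complex.I * (t : ℂ) * (z.re : ℂ))) X =
      cfc (fun z : ℂ => Complex.exp (((t : ℂ) * Complex.I) * z)) X := by
    refine cfc_congr fun z hz => ?_
    rw [re_eq_of_mem hX hz, mul_comm Complex.I]
  have h2 : t • (Complex.I • X) = ((t : ℂ) * Complex.I) • X := by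
    rw [mul_smul, Complex.coe_smul]
  have h3 : IsStarNormal (((t : ℂ) * Complex.I) • X) := by
    rw [← cfc_const_mul_id ((t : ℂ) * Complex.I) X]
    exact cfc_predicate _ _
  rw [h1, ug, h2, ← CFC.complex_exp_eq_normedSpace_exp h3, ← cfc_const_mul_id ((t : ℂ) * Complex.I) X,
    ← cfc_comp' Complex.exp (fun z : ℂ => ((t : ℂ) * Complex.I) * z) X]

theorem norm_ug_le {X : H →L[ℂ] H} (hX : IsSelfAdjoint X) (t : ℝ) : ‖ug X t‖ ≤ 1 := by
  rw [← fc_exp hX]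
  refine norm_cfc_le zero_le_one fun z _ => le_of_eq ?_
  have : Complex.I * (t : ℂ) * (z.re : ℂ) = ((t * z.re : ℝ) : ℂ) * Complex.I := by
    push_cast; ring
  rw [this, Complex.norm_exp_ofReal_mul_I]

theorem hasDerivAt_ug (X : H →L[ℂ] H) (t : ℝ) :
    HasDerivAt (ug X) (ug X t * (Complex.I • X)) t :=
  hasDerivAt_exp_smul_const (𝕂 := ℝ) (Complex.I • X) t

theorem hasDerivAt_ug' (X : H →L[ℂ] H) (t : ℝ) :
    HasDerivAt (ug X) ((Complex.I • X) * ug X t) t :=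
  hasDerivAt_exp_smul_const' (𝕂 := ℝ) (Complex.I • X) t

theorem continuous_ug (X : H →L[ℂ] H) : Continuous (ug X) :=
  continuous_iff_continuousAt.2 fun t => (hasDerivAt_ug X t).continuousAt

theorem ug_zero (X : H →L[ℂ] H) : ug X 0 = 1 := by
  simp [ug, NormedSpace.exp_zero]

theorem TCB.comm_ug {ι : Type*} {e : HilbertBasis ι ℂ H} {X B : H →L[ℂ] H} {C : ℝ}
    (hX : IsSelfAdjoint X) (h : TCB e (B * X - X * B) C) (t : ℝ) :
    TCB e (B * ug X t - ug X t * B) (|t| * C) := by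
  set G : ℝ → H →L[ℂ] H := fun s => ug X s * (B * X - X * B) * ug X (t - s) with hG
  have hGc : Continuous G := by
    have := continuous_ug X
    fun_prop
  have hderiv : ∀ s, HasDerivAt (fun s => ug X s * B * ug X (t - s)) ((-Complex.I) • G s) s := by
    intro s
    have h1 := (hasDerivAt_ug X s).mul_const B
    have h2 : HasDerivAt (fun s => ug X (t - s)) (-((Complex.I • X) * ug X (t - s))) s :=
      (hasDerivAt_ug' X (t - s)).comp_const_sub t s
    refine (h1.mul h2).congr_deriv (Eq.symm ?_)
    change (-Complex.I) • (ug X s * (B * X - X * B) * ug X (t - s)) = _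
    simp only [mul_sub, sub_mul, smul_sub, mul_neg, mul_smul_comm, smul_mul_assoc, neg_smul,
      mul_assoc]
    abel
  have hGc2 : Continuous fun s => (-Complex.I) • G s :=
    hGc.const_smul (-Complex.I)
  have hftc : ∫ s in (0 : ℝ)..t, (-Complex.I) • G s = ug X t * B - B * ug X t := by
    rw [intervalIntegral.integral_eq_sub_of_hasDerivAt (fun s _ => hderiv s)
      (hGc2.intervalIntegrable _ _)]
    simp [ug_zero]
  rw [intervalIntegral.intervalIntegral_eq_integral_uIoc] at hftc
  have hI := TCB.integral (e := e) (μ := volume.restrict (Set.uIoc 0 t))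
    (F := fun s => (-Complex.I) • G s) (c := fun _ => C)
    (intervalIntegrable_iff.1 (hGc2.intervalIntegrable 0 t))
    (intervalIntegrable_iff.1 intervalIntegrable_const)
    (fun s => by
      have := (h.conj (norm_ug_le hX s) (norm_ug_le hX (t - s))).smul (-Complex.I)
      simpa using this)
  have hc : ∫ _ in Set.uIoc 0 t, C = |t| * C := by
    have : max 0 t - min 0 t = |t| := by rw [max_sub_min_eq_abs, sub_zero]
    simp [Set.uIoc, Measure.real, this]
  rw [hc] at hI
  have hfin : B * ug X t - ug X t * B =
      ((if (0 : ℝ) ≤ t then -1 else 1 : ℝ) : ℂ) • ∫ s in Set.uIoc 0 t, (-Complex.I) • G s := by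
    rw [← neg_sub, ← hftc]
    split_ifs <;> simp
  rw [hfin]
  convert hI.smul _ using 1
  split_ifs <;> simp

theorem fc_C11 {X : H →L[ℂ] H} (hX : IsSelfAdjoint X) {g : ℝ → ℂ} (hg : Integrable g) :
    Integrable (fun t => g t • ug X t) ∧
    cfc (fun z : ℂ => ∫ t : ℝ, Complex.exp (Complex.I * (t : ℂ) * (z.re : ℂ)) • g t) X =
      ∫ t : ℝ, g t • ug X t := by
  have hn : IsStarNormal X := hX.isStarNormal
  let E : C(ℝ, C(spectrum ℂ X, ℂ)) :=
    ContinuousMap.curry ⟨fun q : ℝ × spectrum ℂ X =>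
      Complex.exp (Complex.I * (q.1 : ℂ) * ((q.2 : ℂ).re : ℂ)), by fun_prop⟩
  have hE : ∀ t, ‖E t‖ ≤ 1 := by
    intro t
    refine (ContinuousMap.norm_le _ zero_le_one).2 fun z => le_of_eq ?_
    have : Complex.I * (t : ℂ) * ((z : ℂ).re : ℂ) = ((t * (z : ℂ).re : ℝ) : ℂ) * Complex.I := by
      push_cast; ring
    change ‖Complex.exp (Complex.I * (t : ℂ) * ((z : ℂ).re : ℂ))‖ = 1
    rw [this, Complex.norm_exp_ofReal_mul_I]
  have hmk : (fun t : ℝ => ContinuousMap.mkD ((spectrum ℂ X).domRestrict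
      (fun z : ℂ => Complex.exp (Complex.I * (t : ℂ) * (z.re : ℂ)) • g t)) 0) =
      fun t => g t • E t := by
    ext t z
    rw [ContinuousMap.mkD_of_continuous (by simp only [Set.domRestrict_def]; fun_prop)]
    simp [E, mul_comm]
  have hint : Integrable (fun t => g t • E t) := by
    refine Integrable.mono hg (hg.aestronglyMeasurable.smul E.continuous.aestronglyMeasurable) ?_
    refine Filter.Eventually.of_forall fun t => ?_
    rw [norm_smul]
    exact mul_le_of_le_one_right (norm_nonneg _) (hE t)
  have hcf : ∀ t : ℝ, cfc (fun z : ℂ => Complex.exp (Complex.I * (t : ℂ) * (z.re : ℂ)) • g t) X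
      = g t • ug X t := by
    intro t
    rw [← fc_exp hX, ← cfc_smul (g t) _ X]
    simp [mul_comm]
  constructor
  · have := integrable_cfc' (p := IsStarNormal) (μ := volume)
      (fun (t : ℝ) (z : ℂ) => Complex.exp (Complex.I * (t : ℂ) * (z.re : ℂ)) • g t) X
      (by rw [hmk]; exact hint)
    simpa only [hcf] using this
  · rw [cfc_integral' (p := IsStarNormal) (μ := volume)
      (fun (t : ℝ) (z : ℂ) => Complex.exp (Complex.I * (t : ℂ) * (z.re : ℂ)) • g t) X
      (Filter.Eventually.of_forall fun t => by fun_prop) (by rw [hmk]; exact hint)]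
    simp only [hcf]

theorem comm_good {ι : Type*} {e : HilbertBasis ι ℂ H} {X B : H →L[ℂ] H}
    (hX : IsSelfAdjoint X) (h : ∃ C, TCB e (B * X - X * B) C) {φ : ℝ → ℂ} (hφ : GoodFun φ) :
    ∃ C, TCB e (B * fc φ X - fc φ X * B) C := by
  have hn : IsStarNormal X := hX.isStarNormal
  obtain ⟨C, hC⟩ := h
  rcases hφ with ⟨g₀, hg₀, hg₀', hrep⟩ | ⟨p, hp⟩
  · obtain ⟨g, hg, hg', hrep⟩ : ∃ g : ℝ → ℂ, Integrable g ∧ Integrable (fun t : ℝ => t • g t) ∧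
        ∀ β : ℝ, φ β = ∫ t : ℝ, Complex.exp (Complex.I * (t : ℂ) * (β : ℂ)) • g t := by
      refine ⟨fun t => (Real.sqrt (2 * Real.pi))⁻¹ • g₀ t, hg₀.smul (Real.sqrt (2 * Real.pi))⁻¹, ?_, fun β => ?_⟩
      · refine (hg₀'.smul (Real.sqrt (2 * Real.pi))⁻¹).congr
          (Filter.Eventually.of_forall fun t => ?_)
        exact smul_comm (Real.sqrt (2 * Real.pi))⁻¹ t (g₀ t)
      · rw [hrep, ← integral_smul]
        congr 1 with t
        exact smul_comm _ _ _
    obtain ⟨hi, hf⟩ := fc_C11 hX hg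
    have hfc : fc φ X = ∫ t : ℝ, g t • ug X t := by
      rw [← hf, fc]
      simp only [hrep]
    have hint : B * fc φ X - fc φ X * B = ∫ t : ℝ, g t • (B * ug X t - ug X t * B) := by
      rw [hfc, ← integral_const_mul_of_integrable hi,
        ← integral_mul_const_of_integrable hi, ← integral_sub (hi.const_mul B) (hi.mul_const B)]
      simp only [mul_smul_comm, smul_mul_assoc, smul_sub]
    rw [hint]
    refine ⟨_, TCB.integral (c := fun t => ‖g t‖ * (|t| * C)) ?_ ?_ fun t => ?_⟩
    · have := (hi.const_mul B).sub (hi.mul_const B)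
      refine this.congr (Filter.Eventually.of_forall fun t => ?_)
      simp only [Pi.sub_apply, mul_smul_comm, smul_mul_assoc, smul_sub]
    · refine (hg'.norm.mul_const C).congr (Filter.Eventually.of_forall fun t => ?_)
      simp only [norm_smul, Real.norm_eq_abs]
      ring
    · exact (hC.comm_ug hX t).smul (g t)
  · have hfc : fc φ X = aeval X p := by
      rw [fc, ← cfc_polynomial p X]
      refine cfc_congr fun z hz => ?_
      simp only [hp, re_eq_of_mem hX hz]
    rw [hfc]
    clear hfc hp
    induction p using Polynomial.induction_on with
    | C a =>
      refine ⟨0, ?_⟩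
      rw [aeval_C, Algebra.commutes, sub_self]
      intro U V _ _ s
      simp
    | add p q hp hq =>
      obtain ⟨C₁, h₁⟩ := hp
      obtain ⟨C₂, h₂⟩ := hq
      refine ⟨C₁ + C₂, ?_⟩
      convert h₁.add h₂ using 1
      rw [map_add]
      noncomm_ring
    | monomial n a ih =>
      obtain ⟨C₁, h₁⟩ := ih
      obtain ⟨C₂, h₂⟩ := h₁.exists_mul 1 X
      obtain ⟨C₃, h₃⟩ := hC.exists_mul (aeval X (Polynomial.C a * Polynomial.X ^ n)) 1
      refine ⟨C₂ + C₃, ?_⟩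
      convert h₂.add h₃ using 1
      have : aeval X (Polynomial.C a * Polynomial.X ^ (n + 1)) =
          aeval X (Polynomial.C a * Polynomial.X ^ n) * X := by
        rw [pow_succ, ← mul_assoc, map_mul, aeval_X]
      rw [this]
      noncomm_ring

theorem statement6 {ι : Type*} (e : HilbertBasis ι ℂ H) (X Y D2 : H →L[ℂ] H)
    (a b : ℝ) (hA : AssumptionA e X Y D2 a b)
    (ψ φ : ℝ → ℂ) (hψ : GoodFun ψ) (hφ : GoodFun φ) :
    IsTraceClass e (fc ψ Y * fc φ X - fc φ X * fc ψ Y) := by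
  obtain ⟨C, hC⟩ := TCB.of_positive hA.hpos hA.htc
  have hYX : Y * X - X * Y = Complex.I • D2 := by
    have h2 := congrArg (fun Z => ((2 : ℂ)⁻¹ * Complex.I) • Z) hA.hD2
    simp only [smul_smul] at h2
    have e1 : (2 : ℂ)⁻¹ * Complex.I * 2 = Complex.I := by ring
    have e2 : (2 : ℂ)⁻¹ * Complex.I * (-2 * Complex.I) = 1 := by
      ring_nf
      simp
    rw [e1, e2, one_smul] at h2
    exact h2.symm
  obtain ⟨C₁, h₁⟩ := comm_good (e := e) (B := Y) hA.hX ⟨_, hYX ▸ hC.smul Complex.I⟩ hφ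
  have h₂ := h₁.smul (-1)
  rw [neg_one_smul, neg_sub] at h₂
  obtain ⟨C₃, h₃⟩ := comm_good (e := e) (B := fc φ X) hA.hY ⟨_, h₂⟩ hψ
  have h₄ := h₃.smul (-1)
  rw [neg_one_smul, neg_sub] at h₄
  exact h₄.isTraceClass

end HHCP
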